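/- arXiv:2508.05466 — 9 statements merged into one kernel-verified Lean document; each statement's English description precedes it below -/
import Mathlib

section
/- Let G be a block lower-triangular matrix and K a block strictly lower-triangular matrix (with compatible block partitions). Then GK and KG are block strictly lower-triangular, hence nilpotent, so I − GK and I − KG are invertible. Moreover, defining Φ_y = (I − GK)^{-1}, Φ_u = K(I − GK)^{-1}, φ_y = (I − GK)^{-1} G p and φ_u = (I − KG)^{-1} p for any vector p, these satisfy the system-level-synthesis constraints Φ_y − G Φ_u = I and φ_y − G φ_u = 0, and Φ_y is block lower-triangular with all diagonal blocks equal to the identity while Φ_u is block strictly lower-triangular. -/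
open Matrix

namespace Matrix

variable {ι κ l R : Type*}

/-- `A` vanishes strictly above the `r`-th block subdiagonal, where `f` and `g` give the block
indices of rows and columns: `r = 0` is block lower-triangular, `r = 1` block strictly
lower-triangular. -/
def IsBlockLower [Zero R] (f : ι → ℕ) (g : κ → ℕ) (r : ℕ) (A : Matrix ι κ R) : Prop :=
  ∀ i j, f i < g j + r → A i j = 0

theorem IsBlockLower.mul [Fintype κ] [NonUnitalNonAssocSemiring R]
    {f : ι → ℕ} {g : κ → ℕ} {h : l → ℕ} {r s : ℕ} {A : Matrix ι κ R} {B : Matrix κ l R}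
    (hA : IsBlockLower f g r A) (hB : IsBlockLower g h s B) :
    IsBlockLower f h (r + s) (A * B) := by
  intro i k hik
  refine Finset.sum_eq_zero fun j _ => ?_
  by_cases hj : f i < g j + r
  · simp [hA i j hj]
  · simp [hB j k (by lia)]

theorem isBlockLower_one [DecidableEq ι] [Zero R] [One R] (f : ι → ℕ) :
    IsBlockLower f f 0 (1 : Matrix ι ι R) := by
  intro i j hij
  exact one_apply_ne (by rintro rfl; simp at hij)

theorem IsBlockLower.pow [Fintype ι] [DecidableEq ι] [Semiring R] {f : ι → ℕ}
    {r : ℕ} {N : Matrix ι ι R} (hN : IsBlockLower f f r N) (k : ℕ) :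
    IsBlockLower f f (k * r) (N ^ k) := by
  induction k with
  | zero => simpa using isBlockLower_one f
  | succ k ih => simpa only [pow_succ, Nat.succ_mul] using ih.mul hN

theorem IsBlockLower.pow_eq_zero [Fintype ι] [DecidableEq ι] [Semiring R] {f : ι → ℕ}
    {N : Matrix ι ι R} (hN : IsBlockLower f f 1 N) {n : ℕ} (hf : ∀ i, f i < n) :
    N ^ n = 0 := by
  ext i j
  exact hN.pow n i j (by have := hf i; lia)

theorem IsBlockLower.inv_one_sub [Fintype ι] [DecidableEq ι] [CommRing R] {f : ι → ℕ}
    {N : Matrix ι ι R} (hN : IsBlockLower f f 1 N) (hnil : IsNilpotent N) :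
    IsBlockLower f f 0 (1 - N)⁻¹ := by
  obtain ⟨n, hn⟩ := hnil
  have hinv : (1 - N)⁻¹ = ∑ k ∈ Finset.range n, N ^ k :=
    inv_eq_right_inv (by rw [mul_neg_geom_sum, hn, sub_zero])
  intro i j hij
  rw [hinv, sum_apply]
  exact Finset.sum_eq_zero fun k _ => hN.pow k i j (by lia)

/-- The push-through identity. -/
theorem inv_one_sub_mul_mul [Fintype ι] [DecidableEq ι] [Fintype κ] [DecidableEq κ] [CommRing R]
    (A : Matrix ι κ R) (B : Matrix κ ι R)
    (hAB : IsUnit (1 - A * B)) (hBA : IsUnit (1 - B * A)) :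
    (1 - A * B)⁻¹ * A = A * (1 - B * A)⁻¹ := by
  rw [isUnit_iff_isUnit_det] at hAB hBA
  have hcomm : (1 - A * B) * A = A * (1 - B * A) := by
    simp only [Matrix.sub_mul, Matrix.mul_sub, Matrix.one_mul, Matrix.mul_one, Matrix.mul_assoc]
  calc (1 - A * B)⁻¹ * A
      = (1 - A * B)⁻¹ * (A * (1 - B * A)) * (1 - B * A)⁻¹ := by
        rw [← Matrix.mul_assoc, mul_nonsing_inv_cancel_right _ _ hBA]
    _ = A * (1 - B * A)⁻¹ := by rw [← hcomm, nonsing_inv_mul_cancel_left _ _ hAB]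

end Matrix

/-- **Theorem 1, part 1 (achievability).** If `G` is block lower-triangular and `K` is block
strictly lower-triangular (blocks indexed by `Fin (T+1)`, of fixed sizes `q` and `m`), then
`G*K` and `K*G` are block strictly lower-triangular, hence nilpotent, so `I - G*K` and
`I - K*G` are invertible; moreover `Φ_y = (I-GK)⁻¹`, `Φ_u = K(I-GK)⁻¹`, `φ_y = (I-GK)⁻¹ G p`,
`φ_u = (I-KG)⁻¹ p` satisfy the SLS constraints `Φ_y - G Φ_u = I`, `φ_y - G φ_u = 0`, with
`Φ_y` block lower-triangular having identity diagonal blocks and `Φ_u` block strictly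
lower-triangular. -/
theorem sls_achievability {T q m : ℕ}
    (G : Matrix (Fin (T+1) × Fin q) (Fin (T+1) × Fin m) ℝ)
    (K : Matrix (Fin (T+1) × Fin m) (Fin (T+1) × Fin q) ℝ)
    (hG : ∀ i j, i.1 < j.1 → G i j = 0)
    (hK : ∀ i j, i.1 ≤ j.1 → K i j = 0)
    (p : Fin (T+1) × Fin m → ℝ) :
    (∀ i j, i.1 ≤ j.1 → (G * K) i j = 0) ∧
    (∀ i j, i.1 ≤ j.1 → (K * G) i j = 0) ∧
    IsNilpotent (G * K) ∧ IsNilpotent (K * G) ∧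
    IsUnit (1 - G * K) ∧ IsUnit (1 - K * G) ∧
    (1 - G * K)⁻¹ - G * (K * (1 - G * K)⁻¹) = 1 ∧
    ((1 - G * K)⁻¹ *ᵥ (G *ᵥ p)) - G *ᵥ ((1 - K * G)⁻¹ *ᵥ p) = 0 ∧
    (∀ (i j : Fin (T+1) × Fin q), i.1 < j.1 → ((1 - G * K)⁻¹ : Matrix (Fin (T+1) × Fin q) (Fin (T+1) × Fin q) ℝ) i j = 0) ∧
    (∀ (i j : Fin (T+1) × Fin q), i.1 = j.1 →
      ((1 - G * K)⁻¹ : Matrix (Fin (T+1) × Fin q) (Fin (T+1) × Fin q) ℝ) i j = (if i = j then (1:ℝ) else 0)) ∧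
    (∀ (i : Fin (T+1) × Fin m) (j : Fin (T+1) × Fin q), i.1 ≤ j.1 →
      ((K * (1 - G * K)⁻¹ : Matrix (Fin (T+1) × Fin m) (Fin (T+1) × Fin q) ℝ)) i j = 0) := by
  have hG' : IsBlockLower (fun i => (i.1 : ℕ)) (fun j => (j.1 : ℕ)) 0 G :=
    fun i j hij => hG i j (Fin.lt_def.2 hij)
  have hK' : IsBlockLower (fun i => (i.1 : ℕ)) (fun j => (j.1 : ℕ)) 1 K :=
    fun i j hij => hK i j (Fin.le_def.2 (Nat.lt_succ_iff.1 hij))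
  have hGK := hG'.mul hK'
  have hKG := hK'.mul hG'
  have nGK : IsNilpotent (G * K) := ⟨T + 1, hGK.pow_eq_zero fun i => i.1.isLt⟩
  have nKG : IsNilpotent (K * G) := ⟨T + 1, hKG.pow_eq_zero fun i => i.1.isLt⟩
  have uGK := nGK.isUnit_one_sub
  have uKG := nKG.isUnit_one_sub
  have hX := hGK.inv_one_sub nGK
  have sls : (1 - G * K)⁻¹ - G * (K * (1 - G * K)⁻¹) = 1 := by
    have := mul_nonsing_inv _ ((isUnit_iff_isUnit_det _).1 uGK)
    rwa [Matrix.sub_mul, Matrix.one_mul, Matrix.mul_assoc] at this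
  refine ⟨fun i j hij => hGK i j (Nat.lt_succ_of_le hij),
    fun i j hij => hKG i j (Nat.lt_succ_of_le hij), nGK, nKG, uGK, uKG, sls, ?_,
    fun i j hij => hX i j hij, fun i j hij => ?_,
    fun i j hij => (hK'.mul hX) i j (Nat.lt_succ_of_le hij)⟩
  · rw [mulVec_mulVec, mulVec_mulVec, inv_one_sub_mul_mul G K uGK uKG, sub_self]
  · have hGKX := (hG'.mul (hK'.mul hX)) i j (Nat.lt_succ_of_le hij.le)
    have := congrFun₂ sls i j
    rwa [Matrix.sub_apply, hGKX, sub_zero, one_apply] at this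
end

section
/- Let G be block lower-triangular, let Φ_y be block lower-triangular with all diagonal blocks equal to the identity (hence invertible), let Φ_u be block strictly lower-triangular, and let φ_y, φ_u be vectors such that Φ_y − G Φ_u = I and φ_y − G φ_u = 0. Define K = Φ_u Φ_y^{-1} and p = φ_u − K φ_y. Then I − GK and I − KG are invertible and the following four identities hold: (I − GK)^{-1} = Φ_y, K(I − GK)^{-1} = Φ_u, (I − GK)^{-1} G p = φ_y, and (I − KG)^{-1} p = φ_u. -/
open Matrix

/-- A block lower-triangular matrix with identity diagonal blocks has determinant one. -/
theorem Matrix.det_eq_one_of_block_unit_lower {α ι R : Type*} [CommRing R] [LinearOrder α]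
    [Fintype α] [Fintype ι] [DecidableEq ι] (b : ι → α) (M : Matrix ι ι R)
    (hlower : ∀ i j, b i < b j → M i j = 0)
    (hdiag : ∀ i j, b i = b j → M i j = if i = j then 1 else 0) : M.det = 1 := by
  have htri : M.BlockTriangular (OrderDual.toDual ∘ b) := fun i j h => hlower i j h
  rw [htri.det_fintype]
  refine Finset.prod_eq_one fun k _ => ?_
  have hblock : M.toSquareBlock (OrderDual.toDual ∘ b) k = 1 := by
    ext ⟨i, hi⟩ ⟨j, hj⟩
    have hij : b i = b j := OrderDual.toDual.injective (hi.trans hj.symm)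
    simp [toSquareBlock_def, hdiag i j hij, Matrix.one_apply]
  rw [hblock, det_one]

/-- If `A *ᵥ x = y` with `A` invertible, then `A⁻¹ *ᵥ y = x`. -/
theorem Matrix.inv_mulVec_eq_of_mulVec_eq {ι R : Type*} [CommRing R] [Fintype ι] [DecidableEq ι]
    {A : Matrix ι ι R} (hA : IsUnit A) {x y : ι → R} (h : A *ᵥ x = y) : A⁻¹ *ᵥ y = x := by
  rw [← h, mulVec_mulVec, nonsing_inv_mul _ ((isUnit_iff_isUnit_det A).mp hA), one_mulVec]

/-- **Theorem 1, part 2 (realizability).** Any feasible point `(Φ_y, Φ_u, φ_y, φ_u)` of the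
affine SLS subspace (with `G` block lower-triangular, `Φ_y` block lower-triangular with
identity diagonal blocks, `Φ_u` block strictly lower-triangular, `Φ_y - G Φ_u = I`,
`φ_y - G φ_u = 0`) is realized exactly by the affine control law with
`K = Φ_u Φ_y⁻¹`, `p = φ_u - K φ_y`: the matrices `I - GK` and `I - KG` are invertible and
`(I-GK)⁻¹ = Φ_y`, `K(I-GK)⁻¹ = Φ_u`, `(I-GK)⁻¹ G p = φ_y`, `(I-KG)⁻¹ p = φ_u`. -/
theorem sls_realizability {T q m : ℕ}
    (G : Matrix (Fin (T+1) × Fin q) (Fin (T+1) × Fin m) ℝ)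
    (Φy : Matrix (Fin (T+1) × Fin q) (Fin (T+1) × Fin q) ℝ)
    (Φu : Matrix (Fin (T+1) × Fin m) (Fin (T+1) × Fin q) ℝ)
    (φy : Fin (T+1) × Fin q → ℝ) (φu : Fin (T+1) × Fin m → ℝ)
    (hG : ∀ i j, i.1 < j.1 → G i j = 0)
    (hΦy : ∀ i j, i.1 < j.1 → Φy i j = 0)
    (hΦyDiag : ∀ i j, i.1 = j.1 → Φy i j = (if i = j then (1:ℝ) else 0))
    (hΦu : ∀ i j, i.1 ≤ j.1 → Φu i j = 0)
    (hconstr : Φy - G * Φu = 1)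
    (hconstrAff : φy - G *ᵥ φu = 0) :
    IsUnit (1 - G * (Φu * Φy⁻¹)) ∧
    IsUnit (1 - (Φu * Φy⁻¹) * G) ∧
    (1 - G * (Φu * Φy⁻¹))⁻¹ = Φy ∧
    (Φu * Φy⁻¹) * (1 - G * (Φu * Φy⁻¹))⁻¹ = Φu ∧
    (1 - G * (Φu * Φy⁻¹))⁻¹ *ᵥ (G *ᵥ (φu - (Φu * Φy⁻¹) *ᵥ φy)) = φy ∧
    (1 - (Φu * Φy⁻¹) * G)⁻¹ *ᵥ (φu - (Φu * Φy⁻¹) *ᵥ φy) = φu := by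
  have hdet : IsUnit Φy.det := by
    rw [det_eq_one_of_block_unit_lower Prod.fst Φy hΦy hΦyDiag]
    exact isUnit_one
  have hK : Φu * Φy⁻¹ * Φy = Φu := nonsing_inv_mul_cancel_right _ _ hdet
  generalize Φu * Φy⁻¹ = K at hK ⊢
  have hGu : G * Φu = Φy - 1 := by rw [← hconstr]; abel
  have hGφ : G *ᵥ φu = φy := (sub_eq_zero.mp hconstrAff).symm
  have hGK : (1 - G * K) * Φy = 1 := by
    rw [Matrix.sub_mul, Matrix.one_mul, Matrix.mul_assoc, hK, hconstr]
  have hKG : (1 - K * G) * (1 + Φu * G) = 1 := by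
    have hKGΦ : K * G * (Φu * G) = Φu * G - K * G := by
      rw [Matrix.mul_assoc, ← Matrix.mul_assoc G, hGu, ← Matrix.mul_assoc, Matrix.mul_sub, hK,
        Matrix.mul_one, Matrix.sub_mul]
    rw [Matrix.sub_mul, Matrix.one_mul, Matrix.mul_add, Matrix.mul_one, hKGΦ]
    abel
  have uGK : IsUnit (1 - G * K) := IsUnit.of_mul_eq_one _ hGK
  have uKG : IsUnit (1 - K * G) := IsUnit.of_mul_eq_one _ hKG
  have hinv : (1 - G * K)⁻¹ = Φy := inv_eq_right_inv hGK
  refine ⟨uGK, uKG, hinv, by rw [hinv, hK], inv_mulVec_eq_of_mulVec_eq uGK ?_,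
    inv_mulVec_eq_of_mulVec_eq uKG ?_⟩
  · rw [sub_mulVec, one_mulVec, mulVec_sub, hGφ, mulVec_mulVec]
  · rw [sub_mulVec, one_mulVec, ← mulVec_mulVec, hGφ]
end

section
/- Let G and Ĝ be block lower-triangular matrices with model mismatch Δ = G − Ĝ, let Φ̂_y be block lower-triangular, Φ̂_u block strictly lower-triangular, and φ̂_y, φ̂_u vectors satisfying the nominal SLS constraints Φ̂_y − Ĝ Φ̂_u = I and φ̂_y − Ĝ φ̂_u = 0 (so Φ̂_y has identity diagonal blocks and is invertible, and I − Δ Φ̂_u is invertible since Δ Φ̂_u is block strictly lower-triangular). Define K = Φ̂_u Φ̂_y^{-1} and p = φ̂_u − K φ̂_y. Then the true closed-loop responses under the model G are given by: (I − GK)^{-1} = Φ̂_y (I − Δ Φ̂_u)^{-1}, K(I − GK)^{-1} = Φ̂_u (I − Δ Φ̂_u)^{-1}, (I − GK)^{-1} G p = φ̂_y + Φ̂_y (I − Δ Φ̂_u)^{-1} Δ φ̂_u, and (I − KG)^{-1} p = φ̂_u + Φ̂_u (I − Δ Φ̂_u)^{-1} Δ φ̂_u. -/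
open Matrix

/-- A block lower-triangular matrix times a block strictly lower-triangular matrix is block
strictly lower-triangular. -/
theorem mul_apply_eq_zero_of_lower_of_strictLower {α ι κ l R : Type*} [LinearOrder α] [Fintype κ]
    [NonUnitalNonAssocSemiring R] {b : ι → α} {c : κ → α} {d : l → α}
    {L : Matrix ι κ R} {N : Matrix κ l R} (hL : ∀ i j, b i < c j → L i j = 0)
    (hN : ∀ i j, c i ≤ d j → N i j = 0) (i : ι) (j : l) (hij : b i ≤ d j) :
    (L * N) i j = 0 := by
  rw [Matrix.mul_apply]
  refine Finset.sum_eq_zero fun k _ => ?_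
  rcases lt_or_ge (b i) (c k) with h | h
  · rw [hL i k h, zero_mul]
  · rw [hN k j (h.trans hij), mul_zero]

/-- The identity plus a block strictly lower-triangular matrix is invertible. -/
theorem isUnit_one_add_of_strictLower {α ι R : Type*} [LinearOrder α] [Fintype α] [Fintype ι]
    [DecidableEq ι] [CommRing R] {b : ι → α} {N : Matrix ι ι R}
    (hN : ∀ i j, b i ≤ b j → N i j = 0) : IsUnit (1 + N) := by
  have htri : (1 + N).BlockTriangular (OrderDual.toDual ∘ b) := by
    intro i j hij
    have hlt : b i < b j := hij
    have hne : i ≠ j := fun h => hlt.ne (congrArg b h)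
    simp [Matrix.one_apply_ne hne, hN i j hlt.le]
  rw [Matrix.isUnit_iff_isUnit_det, htri.det_fintype]
  have hblock : ∀ k, (1 + N).toSquareBlock (OrderDual.toDual ∘ b) k = 1 := by
    intro k
    ext ⟨i, hi⟩ ⟨j, hj⟩
    have hb : b i = b j := OrderDual.toDual.injective (hi.trans hj.symm)
    simp [Matrix.toSquareBlock_def, Matrix.one_apply, hN i j hb.le]
  simp [hblock]

/-- **Theorem 2.** If the control law `u = K y + p` with `K = Φ̂_u Φ̂_y⁻¹`,
`p = φ̂_u - K φ̂_y` is designed from the nominal SLS parameterization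
`(Φ̂_y, Φ̂_u, φ̂_y, φ̂_u)` for the nominal model `Ĝ` (block lower-triangular, with
`Φ̂_y - Ĝ Φ̂_u = I` and `φ̂_y - Ĝ φ̂_u = 0`) but applied to the true block lower-triangular
model `G = Ĝ + Δ`, then the true closed-loop responses are
`(I-GK)⁻¹ = Φ̂_y (I - Δ Φ̂_u)⁻¹`, `K (I-GK)⁻¹ = Φ̂_u (I - Δ Φ̂_u)⁻¹`,
`(I-GK)⁻¹ G p = φ̂_y + Φ̂_y (I - Δ Φ̂_u)⁻¹ Δ φ̂_u`, and
`(I-KG)⁻¹ p = φ̂_u + Φ̂_u (I - Δ Φ̂_u)⁻¹ Δ φ̂_u`. -/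
theorem sls_model_mismatch {T q m : ℕ}
    (G Gh : Matrix (Fin (T+1) × Fin q) (Fin (T+1) × Fin m) ℝ)
    (Φyh : Matrix (Fin (T+1) × Fin q) (Fin (T+1) × Fin q) ℝ)
    (Φuh : Matrix (Fin (T+1) × Fin m) (Fin (T+1) × Fin q) ℝ)
    (φyh : Fin (T+1) × Fin q → ℝ) (φuh : Fin (T+1) × Fin m → ℝ)
    (hG : ∀ i j, i.1 < j.1 → G i j = 0)
    (hGh : ∀ i j, i.1 < j.1 → Gh i j = 0)
    (hΦyh : ∀ i j, i.1 < j.1 → Φyh i j = 0)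
    (hΦuh : ∀ i j, i.1 ≤ j.1 → Φuh i j = 0)
    (hconstr : Φyh - Gh * Φuh = 1)
    (hconstrAff : φyh - Gh *ᵥ φuh = 0) :
    let Δ := G - Gh
    let K := Φuh * Φyh⁻¹
    let p := φuh - K *ᵥ φyh
    IsUnit Φyh ∧ IsUnit (1 - Δ * Φuh) ∧
    IsUnit (1 - G * K) ∧ IsUnit (1 - K * G) ∧
    (1 - G * K)⁻¹ = Φyh * (1 - Δ * Φuh)⁻¹ ∧
    K * (1 - G * K)⁻¹ = Φuh * (1 - Δ * Φuh)⁻¹ ∧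
    (1 - G * K)⁻¹ *ᵥ (G *ᵥ p) = φyh + (Φyh * (1 - Δ * Φuh)⁻¹ * Δ) *ᵥ φuh ∧
    (1 - K * G)⁻¹ *ᵥ p = φuh + (Φuh * (1 - Δ * Φuh)⁻¹ * Δ) *ᵥ φuh := by
  intro Δ K p
  have hA : Φyh = 1 + Gh * Φuh := sub_eq_iff_eq_add.mp hconstr
  have hφ : φyh = Gh *ᵥ φuh := sub_eq_zero.mp hconstrAff
  have hAunit : IsUnit Φyh := by
    rw [hA]
    exact isUnit_one_add_of_strictLower (b := Prod.fst)
      (mul_apply_eq_zero_of_lower_of_strictLower hGh hΦuh)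
  have hΔ : ∀ i j, i.1 < j.1 → (-Δ) i j = 0 := fun i j h => by
    simp [Δ, hG i j h, hGh i j h]
  have hSunit : IsUnit (1 - Δ * Φuh) := by
    rw [sub_eq_add_neg, ← Matrix.neg_mul]
    exact isUnit_one_add_of_strictLower (b := Prod.fst)
      (mul_apply_eq_zero_of_lower_of_strictLower hΔ hΦuh)
  have hAdet := (Matrix.isUnit_iff_isUnit_det _).mp hAunit
  have hSdet := (Matrix.isUnit_iff_isUnit_det _).mp hSunit
  have hKA : K * Φyh = Φuh := Matrix.nonsing_inv_mul_cancel_right _ _ hAdet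
  have hfactor : (1 - G * K) * Φyh = 1 - Δ * Φuh := by
    rw [Matrix.sub_mul, Matrix.mul_assoc, hKA, one_mul, hA, Matrix.sub_mul]
    abel
  have hright : (1 - G * K) * (Φyh * (1 - Δ * Φuh)⁻¹) = 1 := by
    rw [← Matrix.mul_assoc, hfactor, Matrix.mul_nonsing_inv _ hSdet]
  have hinv : (1 - G * K)⁻¹ = Φyh * (1 - Δ * Φuh)⁻¹ := Matrix.inv_eq_right_inv hright
  have hGKunit : IsUnit (1 - G * K) := IsUnit.of_mul_eq_one _ hright
  have hGKdet := (Matrix.isUnit_iff_isUnit_det _).mp hGKunit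
  have hKinv : K * (1 - G * K)⁻¹ = Φuh * (1 - Δ * Φuh)⁻¹ := by
    rw [hinv, ← Matrix.mul_assoc, hKA]
  have hKGright : (1 - K * G) * (1 + K * (1 - G * K)⁻¹ * G) = 1 := by
    have hpush : (1 - K * G) * K = K * (1 - G * K) := by
      simp only [Matrix.sub_mul, Matrix.mul_sub, Matrix.one_mul, Matrix.mul_one, Matrix.mul_assoc]
    rw [Matrix.mul_add, Matrix.mul_one, ← Matrix.mul_assoc, ← Matrix.mul_assoc, hpush,
      Matrix.mul_nonsing_inv_cancel_right _ _ hGKdet, sub_add_cancel]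
  have hGp : G *ᵥ p = (1 - G * K) *ᵥ φyh + Δ *ᵥ φuh := by
    simp only [p, Δ, Matrix.mulVec_sub, Matrix.sub_mulVec, Matrix.one_mulVec,
      Matrix.mulVec_mulVec, ← hφ]
    abel
  have hy : (1 - G * K)⁻¹ *ᵥ (G *ᵥ p) = φyh + (Φyh * (1 - Δ * Φuh)⁻¹ * Δ) *ᵥ φuh := by
    rw [hGp, Matrix.mulVec_add, Matrix.mulVec_mulVec, Matrix.nonsing_inv_mul _ hGKdet,
      Matrix.one_mulVec, Matrix.mulVec_mulVec, hinv]
  refine ⟨hAunit, hSunit, hGKunit, IsUnit.of_mul_eq_one _ hKGright, hinv, hKinv, hy, ?_⟩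
  rw [Matrix.inv_eq_right_inv hKGright, Matrix.add_mulVec, Matrix.one_mulVec,
    ← Matrix.mulVec_mulVec, ← Matrix.mulVec_mulVec, hy, Matrix.mulVec_add, Matrix.mulVec_mulVec,
    ← Matrix.mul_assoc, ← Matrix.mul_assoc, hKA]
  simp only [p]
  abel
end

section
/- Let real matrices Δ, Θ̃ and vector ỹ₀ satisfy ‖Δ‖ ≤ γ₁, ‖Θ̃‖ ≤ γ₂, ‖ỹ₀‖ ≤ γ₃ with γ₁ > 0. Let Φ̂_y, Φ̂_u satisfy ‖Φ̂_y‖ ≤ σ and γ₁‖Φ̂_u‖ ≤ ρ with 0 ≤ ρ < 1, let Φ̂ denote the vertical stacking of Φ̂_y and Φ̂_u, and set R_Φ = (I − ΔΦ̂_u)^{-1} (which exists since ‖ΔΦ̂_u‖ ≤ ρ < 1). Given disturbance samples e₁,…,e_N, vectors ŷ₀, φ̂_u, matrix Θ̂, and κ ≥ 0, define for each i the predicted response η̂_i = Φ̂(ŷ₀ + Θ̂ e_i) + φ̂ and true response η_i = Φ̂ R_Φ(ŷ₀ + ỹ₀ + (Θ̂+Θ̃) e_i) + φ̂ + Φ̂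 R_Φ Δ φ̂_u (where φ̂ stacks φ̂_y, φ̂_u). Then (1/N) Σ_{i=1}^{N} ‖η̂_i − η_i‖ + κ‖Φ̂ R_Φ (Θ̂ + Θ̃)‖ ≤ (‖Φ̂‖/(N(1−ρ))) [ Σ_{i=1}^{N} ( ρ‖ŷ₀ + Θ̂ e_i‖ + γ₂‖e_i‖ ) + Nγ₃ ] + (ρ/γ₁ + σ)·(γ₁/(1−ρ))·‖φ̂_u‖ + (κ/(1−ρ))‖Φ̂‖(‖Θ̂‖ + γ₂). -/
open Matrix

/-- The 1-norm of a real vector. -/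
noncomputable def vnorm {n : Type*} [Fintype n] (v : n → ℝ) : ℝ := ∑ i, |v i|

/-- The matrix norm induced by the vector 1-norm (maximum absolute column sum). -/
noncomputable def mnorm {m n : Type*} [Fintype m] [Fintype n] (M : Matrix m n ℝ) : ℝ :=
  sSup (Set.range fun j : n => ∑ i, |M i j|)

theorem vnorm_nonneg {n : Type*} [Fintype n] (v : n → ℝ) : 0 ≤ vnorm v :=
  Finset.sum_nonneg fun _ _ => abs_nonneg _

theorem vnorm_add_le {n : Type*} [Fintype n] (v w : n → ℝ) :
    vnorm (v + w) ≤ vnorm v + vnorm w := by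
  unfold vnorm
  rw [← Finset.sum_add_distrib]
  exact Finset.sum_le_sum fun i _ => abs_add_le _ _

theorem vnorm_neg {n : Type*} [Fintype n] (v : n → ℝ) : vnorm (-v) = vnorm v := by
  simp [vnorm]

theorem mnorm_nonneg {m n : Type*} [Fintype m] [Fintype n] (M : Matrix m n ℝ) :
    0 ≤ mnorm M := by
  apply Real.sSup_nonneg
  rintro _ ⟨j, rfl⟩
  exact Finset.sum_nonneg fun _ _ => abs_nonneg _

theorem sum_abs_col_le_mnorm {m n : Type*} [Fintype m] [Fintype n] (M : Matrix m n ℝ) (j : n) :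
    ∑ i, |M i j| ≤ mnorm M :=
  le_csSup (Set.finite_range _).bddAbove ⟨j, rfl⟩

theorem mnorm_le {m n : Type*} [Fintype m] [Fintype n] {M : Matrix m n ℝ} {c : ℝ}
    (hc : 0 ≤ c) (h : ∀ j, ∑ i, |M i j| ≤ c) : mnorm M ≤ c := by
  apply Real.sSup_le _ hc
  rintro _ ⟨j, rfl⟩
  exact h j

theorem vnorm_mulVec_le {m n : Type*} [Fintype m] [Fintype n] (M : Matrix m n ℝ) (v : n → ℝ) :
    vnorm (M *ᵥ v) ≤ mnorm M * vnorm v := by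
  calc vnorm (M *ᵥ v) ≤ ∑ i, ∑ j, |M i j| * |v j| := by
        refine Finset.sum_le_sum fun i _ => ?_
        simp only [Matrix.mulVec, dotProduct, ← abs_mul]
        exact Finset.abs_sum_le_sum_abs _ _
    _ = ∑ j, (∑ i, |M i j|) * |v j| := by
        rw [Finset.sum_comm]
        simp only [Finset.sum_mul]
    _ ≤ ∑ j, mnorm M * |v j| := Finset.sum_le_sum fun j _ =>
        mul_le_mul_of_nonneg_right (sum_abs_col_le_mnorm M j) (abs_nonneg _)
    _ = mnorm M * vnorm v := by rw [vnorm, Finset.mul_sum]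

theorem mnorm_le_of_vnorm_mulVec_le {m n : Type*} [Fintype m] [Fintype n] {M : Matrix m n ℝ}
    {c : ℝ} (hc : 0 ≤ c) (h : ∀ v, vnorm (M *ᵥ v) ≤ c * vnorm v) : mnorm M ≤ c := by
  classical
  refine mnorm_le hc fun j => ?_
  have hj := h (Pi.single j 1)
  have hs : vnorm (Pi.single j (1 : ℝ) : n → ℝ) = 1 := by
    simp [vnorm, Pi.single_apply, apply_ite abs]
  rw [hs, mul_one, Matrix.mulVec_single_one] at hj
  exact hj

theorem mnorm_add_le {m n : Type*} [Fintype m] [Fintype n] (A B : Matrix m n ℝ) :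
    mnorm (A + B) ≤ mnorm A + mnorm B := by
  refine mnorm_le_of_vnorm_mulVec_le (add_nonneg (mnorm_nonneg A) (mnorm_nonneg B)) fun v => ?_
  rw [Matrix.add_mulVec, add_mul]
  exact (vnorm_add_le _ _).trans (add_le_add (vnorm_mulVec_le A v) (vnorm_mulVec_le B v))

theorem mnorm_mul_le {l m n : Type*} [Fintype l] [Fintype m] [Fintype n]
    (A : Matrix l m ℝ) (B : Matrix m n ℝ) : mnorm (A * B) ≤ mnorm A * mnorm B := by
  refine mnorm_le_of_vnorm_mulVec_le (mul_nonneg (mnorm_nonneg A) (mnorm_nonneg B)) fun v => ?_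
  rw [← Matrix.mulVec_mulVec, mul_assoc]
  exact (vnorm_mulVec_le A _).trans
    (mul_le_mul_of_nonneg_left (vnorm_mulVec_le B v) (mnorm_nonneg A))

theorem mnorm_fromRows_le {m₁ m₂ n : Type*} [Fintype m₁] [Fintype m₂] [Fintype n]
    (A : Matrix m₁ n ℝ) (B : Matrix m₂ n ℝ) :
    mnorm (Matrix.fromRows A B) ≤ mnorm A + mnorm B := by
  refine mnorm_le (add_nonneg (mnorm_nonneg A) (mnorm_nonneg B)) fun j => ?_
  simpa [Fintype.sum_sum_type] using
    add_le_add (sum_abs_col_le_mnorm A j) (sum_abs_col_le_mnorm B j)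

theorem one_sub_mul_vnorm_le {n : Type*} [Fintype n] [DecidableEq n] {A : Matrix n n ℝ} {ρ : ℝ}
    (hA : mnorm A ≤ ρ) (v : n → ℝ) : (1 - ρ) * vnorm v ≤ vnorm ((1 - A) *ᵥ v) := by
  have hv : v = (1 - A) *ᵥ v + A *ᵥ v := by simp [Matrix.sub_mulVec]
  have h₁ := vnorm_add_le ((1 - A) *ᵥ v) (A *ᵥ v)
  rw [← hv] at h₁
  have h₂ := (vnorm_mulVec_le A v).trans (mul_le_mul_of_nonneg_right hA (vnorm_nonneg v))
  linarith

theorem isUnit_one_sub_of_mnorm_lt_one {n : Type*} [Fintype n] [DecidableEq n]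
    {A : Matrix n n ℝ} (hA : mnorm A < 1) : IsUnit (1 - A) := by
  rw [← Matrix.mulVec_injective_iff_isUnit]
  intro v w hvw
  have h := one_sub_mul_vnorm_le le_rfl (A := A) (v - w)
  rw [Matrix.mulVec_sub, sub_eq_zero.mpr hvw] at h
  have h0 : vnorm (v - w) = 0 := by
    have hz : vnorm (0 : n → ℝ) = 0 := by simp [vnorm]
    rw [hz] at h
    exact le_antisymm (nonpos_of_mul_nonpos_right h (sub_pos.mpr hA)) (vnorm_nonneg _)
  funext i
  have hi := (Finset.sum_eq_zero_iff_of_nonneg fun i _ => abs_nonneg ((v - w) i)).mp h0 i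
    (Finset.mem_univ i)
  exact sub_eq_zero.mp (abs_eq_zero.mp hi)

theorem mnorm_inv_one_sub_le {n : Type*} [Fintype n] [DecidableEq n] {A : Matrix n n ℝ} {ρ : ℝ}
    (hA : mnorm A ≤ ρ) (hρ : ρ < 1) : mnorm (1 - A)⁻¹ ≤ (1 - ρ)⁻¹ := by
  have hpos : 0 < 1 - ρ := sub_pos.mpr hρ
  refine mnorm_le_of_vnorm_mulVec_le (inv_nonneg.mpr hpos.le) fun v => ?_
  have hdet := (Matrix.isUnit_iff_isUnit_det _).mp
    (isUnit_one_sub_of_mnorm_lt_one (hA.trans_lt hρ))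
  have h := one_sub_mul_vnorm_le hA ((1 - A)⁻¹ *ᵥ v)
  rw [Matrix.mulVec_mulVec, Matrix.mul_nonsing_inv _ hdet, Matrix.one_mulVec] at h
  rwa [le_inv_mul_iff₀ hpos]

/-- **Proposition 1 combined with constraint (27e) of Theorem 3 (deterministic content).**
Under the stated norm bounds on the model mismatch `(Δ, Θ̃, ỹ₀)` and on the nominal
closed-loop response `(Φ̂_y, Φ̂_u)`, with `R_Φ = (I - Δ Φ̂_u)⁻¹`, the average 1-norm
deviation between the predicted responses `η̂_i` and the true responses `η_i` plus
`κ ‖Φ̂ R_Φ (Θ̂ + Θ̃)‖` is bounded by the tractable expression of (27e). -/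
theorem wasserstein_bound_tractable
    {α β ε : Type*} [Fintype α] [Fintype β] [Fintype ε] [DecidableEq α]
    (Δ : Matrix α β ℝ) (Θt : Matrix α ε ℝ) (yt0 : α → ℝ)
    (Φy : Matrix α α ℝ) (Φu : Matrix β α ℝ)
    (Θh : Matrix α ε ℝ) (yh0 : α → ℝ) (φy : α → ℝ) (φu : β → ℝ)
    (γ₁ γ₂ γ₃ ρ σ κ : ℝ) (N : ℕ) (hN : 0 < N) (e : Fin N → ε → ℝ)
    (hΔ : mnorm Δ ≤ γ₁) (hΘt : mnorm Θt ≤ γ₂) (hyt0 : vnorm yt0 ≤ γ₃)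
    (hγ₁ : 0 < γ₁) (hσ : mnorm Φy ≤ σ) (hρ : γ₁ * mnorm Φu ≤ ρ)
    (hρ0 : 0 ≤ ρ) (hρ1 : ρ < 1) (hκ : 0 ≤ κ) :
    let Φ := Matrix.fromRows Φy Φu
    let φ := Sum.elim φy φu
    let RΦ := (1 - Δ * Φu)⁻¹
    let ηh := fun i : Fin N => Φ *ᵥ (yh0 + Θh *ᵥ e i) + φ
    let η := fun i : Fin N =>
      (Φ * RΦ) *ᵥ (yh0 + yt0 + (Θh + Θt) *ᵥ e i) + φ + (Φ * RΦ * Δ) *ᵥ φu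
    (1 / (N : ℝ)) * ∑ i, vnorm (ηh i - η i) + κ * mnorm (Φ * RΦ * (Θh + Θt)) ≤
      (mnorm Φ / ((N : ℝ) * (1 - ρ))) *
        ((∑ i, (ρ * vnorm (yh0 + Θh *ᵥ e i) + γ₂ * vnorm (e i))) + (N : ℝ) * γ₃) +
      (ρ / γ₁ + σ) * (γ₁ / (1 - ρ)) * vnorm φu +
      (κ / (1 - ρ)) * mnorm Φ * (mnorm Θh + γ₂) := by
  intro Φ φ RΦ ηh η
  have hpos : 0 < 1 - ρ := sub_pos.mpr hρ1
  have hNpos : (0 : ℝ) < N := Nat.cast_pos.mpr hN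
  have hA : mnorm (Δ * Φu) ≤ ρ :=
    (mnorm_mul_le Δ Φu).trans ((mul_le_mul_of_nonneg_right hΔ (mnorm_nonneg Φu)).trans hρ)
  have hdet : IsUnit (1 - Δ * Φu).det := (Matrix.isUnit_iff_isUnit_det _).mp
    (isUnit_one_sub_of_mnorm_lt_one (hA.trans_lt hρ1))
  have hΦ0 : 0 ≤ mnorm Φ := mnorm_nonneg Φ
  have hΦR : mnorm (Φ * RΦ) ≤ mnorm Φ * (1 - ρ)⁻¹ := (mnorm_mul_le Φ RΦ).trans
    (mul_le_mul_of_nonneg_left (mnorm_inv_one_sub_le hA hρ1) hΦ0)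
  have hc0 : 0 ≤ mnorm Φ * (1 - ρ)⁻¹ := mul_nonneg hΦ0 (inv_nonneg.mpr hpos.le)
  have hΦ : mnorm Φ ≤ ρ / γ₁ + σ := by
    have hu : mnorm Φu ≤ ρ / γ₁ := by
      rw [le_div_iff₀ hγ₁, mul_comm]
      exact hρ
    linarith [mnorm_fromRows_le Φy Φu]
  have hΦRdiff (w : α → ℝ) : Φ *ᵥ w = (Φ * RΦ) *ᵥ (w - (Δ * Φu) *ᵥ w) := by
    have hw : w - (Δ * Φu) *ᵥ w = (1 - Δ * Φu) *ᵥ w := by simp [Matrix.sub_mulVec]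
    rw [hw, Matrix.mulVec_mulVec, Matrix.mul_assoc, Matrix.nonsing_inv_mul _ hdet,
      Matrix.mul_one]
  have hdiff (i : Fin N) : ηh i - η i = -((Φ * RΦ) *ᵥ
      ((Δ * Φu) *ᵥ (yh0 + Θh *ᵥ e i) + Θt *ᵥ e i + yt0 + Δ *ᵥ φu)) := by
    simp only [ηh, η]
    rw [hΦRdiff (yh0 + Θh *ᵥ e i), ← Matrix.mulVec_mulVec φu (Φ * RΦ) Δ, Matrix.add_mulVec]
    simp only [Matrix.mulVec_add, Matrix.mulVec_sub]
    abel
  have hbound (i : Fin N) : vnorm (ηh i - η i) ≤ mnorm Φ * (1 - ρ)⁻¹ *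
      ((ρ * vnorm (yh0 + Θh *ᵥ e i) + γ₂ * vnorm (e i)) + (γ₃ + γ₁ * vnorm φu)) := by
    rw [hdiff, vnorm_neg]
    refine (vnorm_mulVec_le _ _).trans (mul_le_mul hΦR ?_ (vnorm_nonneg _) hc0)
    have h₁ := (vnorm_mulVec_le (Δ * Φu) (yh0 + Θh *ᵥ e i)).trans
      (mul_le_mul_of_nonneg_right hA (vnorm_nonneg _))
    have h₂ := (vnorm_mulVec_le Θt (e i)).trans
      (mul_le_mul_of_nonneg_right hΘt (vnorm_nonneg _))
    have h₃ := (vnorm_mulVec_le Δ φu).trans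
      (mul_le_mul_of_nonneg_right hΔ (vnorm_nonneg _))
    have h₄ := vnorm_add_le ((Δ * Φu) *ᵥ (yh0 + Θh *ᵥ e i) + Θt *ᵥ e i + yt0) (Δ *ᵥ φu)
    have h₅ := vnorm_add_le ((Δ * Φu) *ᵥ (yh0 + Θh *ᵥ e i) + Θt *ᵥ e i) yt0
    have h₆ := vnorm_add_le ((Δ * Φu) *ᵥ (yh0 + Θh *ᵥ e i)) (Θt *ᵥ e i)
    linarith
  have hmean : (1 / (N : ℝ)) * ∑ i, vnorm (ηh i - η i) ≤
      (mnorm Φ / ((N : ℝ) * (1 - ρ))) *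
        ((∑ i, (ρ * vnorm (yh0 + Θh *ᵥ e i) + γ₂ * vnorm (e i))) + (N : ℝ) * γ₃) +
      mnorm Φ * (γ₁ / (1 - ρ) * vnorm φu) := by
    have hsum := Finset.sum_le_sum fun i (_ : i ∈ Finset.univ) => hbound i
    rw [← Finset.mul_sum, Finset.sum_add_distrib, Finset.sum_const, Finset.card_univ,
      Fintype.card_fin, nsmul_eq_mul] at hsum
    refine (mul_le_mul_of_nonneg_left hsum (one_div_pos.mpr hNpos).le).trans_eq ?_
    field_simp
    ring
  have hφu : mnorm Φ * (γ₁ / (1 - ρ) * vnorm φu) ≤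
      (ρ / γ₁ + σ) * (γ₁ / (1 - ρ)) * vnorm φu := by
    rw [mul_assoc (ρ / γ₁ + σ)]
    exact mul_le_mul_of_nonneg_right hΦ
      (mul_nonneg (div_nonneg hγ₁.le hpos.le) (vnorm_nonneg φu))
  have hκΘ : κ * mnorm (Φ * RΦ * (Θh + Θt)) ≤
      (κ / (1 - ρ)) * mnorm Φ * (mnorm Θh + γ₂) := by
    have hΘ : mnorm (Θh + Θt) ≤ mnorm Θh + γ₂ := by linarith [mnorm_add_le Θh Θt]
    have h := (mnorm_mul_le (Φ * RΦ) (Θh + Θt)).trans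
      (mul_le_mul hΦR hΘ (mnorm_nonneg _) hc0)
    refine (mul_le_mul_of_nonneg_left h hκ).trans_eq ?_
    rw [div_eq_mul_inv]
    ring
  linarith
end

section
/- Let G, Φ_y, Φ_u be square real matrices with Φ_y invertible and G Φ_u = Φ_y − I, and set K = Φ_u Φ_y^{-1}. Then I − GK is invertible and K (I − GK)^{-1} = Φ_u. -/
open Matrix

/-- **Second closed-loop identity in the proof of Theorem 1.** If `Φ_y` is invertible,
`G Φ_u = Φ_y - I`, and `K = Φ_u Φ_y⁻¹`, then `I - GK` is invertible and
`K (I - GK)⁻¹ = Φ_u`. -/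
theorem closed_loop_input_response {n : Type*} [Fintype n] [DecidableEq n]
    (G Φy Φu : Matrix n n ℝ) (hΦy : IsUnit Φy) (h : G * Φu = Φy - 1) :
    let K := Φu * Φy⁻¹
    IsUnit (1 - G * K) ∧ K * (1 - G * K)⁻¹ = Φu := by
  intro K
  have hdet : IsUnit Φy.det := (isUnit_iff_isUnit_det Φy).mp hΦy
  have hK : 1 - G * K = Φy⁻¹ := by
    rw [← Matrix.mul_assoc, h, Matrix.sub_mul, mul_nonsing_inv _ hdet, Matrix.one_mul,
      sub_sub_cancel]
  rw [hK, nonsing_inv_nonsing_inv _ hdet]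
  exact ⟨isUnit_nonsing_inv_iff.mpr hΦy, nonsing_inv_mul_cancel_right _ _ hdet⟩
end

section
/- Let G, Φ_y, Φ_u be square real matrices with Φ_y invertible and G Φ_u = Φ_y − I, let φ_y, φ_u be vectors with G φ_u = φ_y, and set K = Φ_u Φ_y^{-1} and p = φ_u − K φ_y. Then I − GK is invertible and (I − GK)^{-1} G p = φ_y. -/
open Matrix

/-- **Third closed-loop identity in the proof of Theorem 1.** If `Φ_y` is invertible,
`G Φ_u = Φ_y - I`, `G φ_u = φ_y`, `K = Φ_u Φ_y⁻¹` and `p = φ_u - K φ_y`, then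
`I - GK` is invertible and `(I - GK)⁻¹ G p = φ_y`. -/
theorem closed_loop_affine_output {n : Type*} [Fintype n] [DecidableEq n]
    (G Φy Φu : Matrix n n ℝ) (φy φu : n → ℝ)
    (hΦy : IsUnit Φy) (h : G * Φu = Φy - 1) (hφ : G *ᵥ φu = φy) :
    let K := Φu * Φy⁻¹
    let p := φu - K *ᵥ φy
    IsUnit (1 - G * K) ∧ (1 - G * K)⁻¹ *ᵥ (G *ᵥ p) = φy := by
  intro K p
  have hK : 1 - G * K = Φy⁻¹ := by
    rw [← Matrix.mul_assoc, h, Matrix.sub_mul,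
      Matrix.mul_nonsing_inv _ ((Matrix.isUnit_iff_isUnit_det _).1 hΦy), Matrix.one_mul,
      sub_sub_cancel]
  have hu : IsUnit (1 - G * K) := hK ▸ Matrix.isUnit_nonsing_inv_iff.2 hΦy
  have hp : G *ᵥ p = (1 - G * K) *ᵥ φy := by
    rw [Matrix.mulVec_sub, hφ, Matrix.mulVec_mulVec, Matrix.sub_mulVec, Matrix.one_mulVec]
  refine ⟨hu, ?_⟩
  rw [hp, Matrix.mulVec_mulVec,
    Matrix.nonsing_inv_mul _ ((Matrix.isUnit_iff_isUnit_det _).1 hu), Matrix.one_mulVec]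
end

section
/- Let G, Φ_y, Φ_u be square real matrices with Φ_y invertible and G Φ_u = Φ_y − I, let φ_y, φ_u be vectors with G φ_u = φ_y, and set K = Φ_u Φ_y^{-1} and p = φ_u − K φ_y. Then I − KG is invertible and (I − KG)^{-1} p = φ_u. -/
open Matrix

/-- **Fourth closed-loop identity in the proof of Theorem 1.** If `Φ_y` is invertible,
`G Φ_u = Φ_y - I`, `G φ_u = φ_y`, `K = Φ_u Φ_y⁻¹` and `p = φ_u - K φ_y`, then
`I - KG` is invertible and `(I - KG)⁻¹ p = φ_u`. -/
theorem closed_loop_affine_input {n : Type*} [Fintype n] [DecidableEq n]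
    (G Φy Φu : Matrix n n ℝ) (φy φu : n → ℝ)
    (hΦy : IsUnit Φy) (h : G * Φu = Φy - 1) (hφ : G *ᵥ φu = φy) :
    let K := Φu * Φy⁻¹
    let p := φu - K *ᵥ φy
    IsUnit (1 - K * G) ∧ (1 - K * G)⁻¹ *ᵥ p = φu := by
  intro K p
  have hK : K * Φy = Φu := by
    rw [Matrix.mul_assoc, nonsing_inv_mul _ ((isUnit_iff_isUnit_det _).mp hΦy), Matrix.mul_one]
  have hKGΦu : K * G * Φu = Φu - K := by
    rw [Matrix.mul_assoc, h, Matrix.mul_sub, hK, Matrix.mul_one]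
  have hinv : (1 - K * G) * (1 + Φu * G) = 1 := by
    have hKGΦuG : K * G * (Φu * G) = Φu * G - K * G := by
      rw [← Matrix.mul_assoc, hKGΦu, Matrix.sub_mul]
    rw [Matrix.sub_mul, Matrix.one_mul, Matrix.mul_add, Matrix.mul_one, hKGΦuG]
    abel
  have hunit : IsUnit (1 - K * G) :=
    (isUnit_iff_isUnit_det _).mpr (isUnit_det_of_right_inverse hinv)
  have hp : p = (1 - K * G) *ᵥ φu := by
    rw [sub_mulVec, one_mulVec, ← mulVec_mulVec, hφ]
  refine ⟨hunit, ?_⟩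
  rw [hp, mulVec_mulVec, nonsing_inv_mul _ ((isUnit_iff_isUnit_det _).mp hunit), one_mulVec]
end

section
/- Let G, Ĝ be square real matrices with Δ = G − Ĝ, and let Φ̂_y, Φ̂_u satisfy Φ̂_y − Ĝ Φ̂_u = I, with Φ̂_y invertible and I − Δ Φ̂_u invertible. Then Φ_y := Φ̂_y (I − Δ Φ̂_u)^{-1} and Φ_u := Φ̂_u (I − Δ Φ̂_u)^{-1} satisfy the true SLS constraint Φ_y − G Φ_u = I; moreover Φ_y is invertible and Φ_u Φ_y^{-1} = Φ̂_u Φ̂_y^{-1}, i.e., the realized feedback gain K is the same for the nominal and the true closed-loop parameterizations. -/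
open Matrix

/-- **Identity (20) in the proof of Theorem 2.** If `Φ̂_y - Ĝ Φ̂_u = I` with `Φ̂_y`
invertible and `I - Δ Φ̂_u` invertible, where `Δ = G - Ĝ`, then
`Φ_y = Φ̂_y (I - Δ Φ̂_u)⁻¹` and `Φ_u = Φ̂_u (I - Δ Φ̂_u)⁻¹` satisfy the true SLS
constraint `Φ_y - G Φ_u = I`; moreover `Φ_y` is invertible and
`Φ_u Φ_y⁻¹ = Φ̂_u Φ̂_y⁻¹`, i.e., the realized feedback gain is unchanged. -/
theorem sls_true_parameterization {n : Type*} [Fintype n] [DecidableEq n]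
    (G Gh Φyh Φuh : Matrix n n ℝ)
    (hconstr : Φyh - Gh * Φuh = 1)
    (hΦyh : IsUnit Φyh)
    (hinv : IsUnit (1 - (G - Gh) * Φuh)) :
    let Φy := Φyh * (1 - (G - Gh) * Φuh)⁻¹
    let Φu := Φuh * (1 - (G - Gh) * Φuh)⁻¹
    Φy - G * Φu = 1 ∧ IsUnit Φy ∧ Φu * Φy⁻¹ = Φuh * Φyh⁻¹ := by
  intro Φy Φu
  have hdet := (Matrix.isUnit_iff_isUnit_det _).mp hinv
  have hsub : Φyh - G * Φuh = 1 - (G - Gh) * Φuh := by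
    rw [← hconstr]
    noncomm_ring
  refine ⟨?_, hΦyh.mul (Matrix.isUnit_nonsing_inv_iff.mpr hinv), ?_⟩
  · simp only [Φy, Φu]
    rw [← Matrix.mul_assoc, ← Matrix.sub_mul, hsub, Matrix.mul_nonsing_inv _ hdet]
  · simp only [Φy, Φu]
    rw [Matrix.mul_inv_rev, Matrix.nonsing_inv_nonsing_inv _ hdet, Matrix.mul_assoc,
      Matrix.nonsing_inv_mul_cancel_left _ _ hdet]
end

section
/- Let Δ, Φ̂_y, Φ̂_u be real matrices and φ̂_u a vector with ‖Δ‖ ≤ γ₁ for some γ₁ > 0, γ₁‖Φ̂_u‖ ≤ ρ for some 0 ≤ ρ < 1, and ‖Φ̂_y‖ ≤ σ. Then ‖[Φ̂_y; Φ̂_u] (I − Δ Φ̂_u)^{-1} Δ φ̂_u‖ ≤ (ρ/γ₁ + σ) · (γ₁/(1 − ρ)) · ‖φ̂_u‖, where [Φ̂_y; Φ̂_u] denotes the vertical stacking of Φ̂_y and Φ̂_u. -/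
open Matrix

theorem vnorm_fromRows_mulVec {a b k : Type*} [Fintype a] [Fintype b] [Fintype k]
    (A : Matrix a k ℝ) (B : Matrix b k ℝ) (v : k → ℝ) :
    vnorm (Matrix.fromRows A B *ᵥ v) = vnorm (A *ᵥ v) + vnorm (B *ᵥ v) := by
  simp [vnorm, Matrix.fromRows_mulVec]

/-- If `x = w + y` with `‖y‖ ≤ ρ ‖x‖` and `ρ < 1`, then `‖x‖ ≤ ‖w‖ / (1 - ρ)`. -/
theorem vnorm_le_div_of_eq_add {n : Type*} [Fintype n] {x w y : n → ℝ} {ρ : ℝ} (hρ : ρ < 1)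
    (hx : x = w + y) (hy : vnorm y ≤ ρ * vnorm x) : vnorm x ≤ vnorm w / (1 - ρ) := by
  have h := vnorm_add_le w y
  rw [← hx] at h
  rw [le_div_iff₀ (sub_pos.2 hρ)]
  linarith

/-- **Term-3 bound (35) in the proof of Theorem 3.** If `‖Δ‖ ≤ γ₁` with `γ₁ > 0`,
`γ₁ ‖Φ̂_u‖ ≤ ρ < 1`, and `‖Φ̂_y‖ ≤ σ`, then
`‖[Φ̂_y; Φ̂_u] (I - Δ Φ̂_u)⁻¹ Δ φ̂_u‖ ≤ (ρ/γ₁ + σ) (γ₁/(1-ρ)) ‖φ̂_u‖`. -/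
theorem term3_bound {a b k : Type*} [Fintype a] [Fintype b] [Fintype k] [DecidableEq k]
    (Φyh : Matrix a k ℝ) (Φuh : Matrix b k ℝ) (Δ : Matrix k b ℝ) (φuh : b → ℝ)
    (γ₁ ρ σ : ℝ) (hγ₁ : 0 < γ₁) (hΔ : mnorm Δ ≤ γ₁)
    (hρ0 : 0 ≤ ρ) (hρ1 : ρ < 1) (hΦuh : γ₁ * mnorm Φuh ≤ ρ) (hΦyh : mnorm Φyh ≤ σ) :
    vnorm ((Matrix.fromRows Φyh Φuh * (1 - Δ * Φuh)⁻¹ * Δ) *ᵥ φuh) ≤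
      (ρ / γ₁ + σ) * (γ₁ / (1 - ρ)) * vnorm φuh := by
  have hσ : 0 ≤ σ := (mnorm_nonneg _).trans hΦyh
  have hv := vnorm_nonneg φuh
  have h1ρ : 0 < 1 - ρ := sub_pos.2 hρ1
  by_cases hu : IsUnit (1 - Δ * Φuh).det
  · set x := (1 - Δ * Φuh)⁻¹ *ᵥ (Δ *ᵥ φuh) with hx
    have hfix : x = Δ *ᵥ φuh + Δ *ᵥ (Φuh *ᵥ x) := by
      have h : (1 - Δ * Φuh) *ᵥ x = Δ *ᵥ φuh := by
        rw [hx, Matrix.mulVec_mulVec, Matrix.mul_nonsing_inv _ hu, Matrix.one_mulVec]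
      rw [← h, Matrix.sub_mulVec, Matrix.one_mulVec, Matrix.mulVec_mulVec x Δ Φuh, sub_add_cancel]
    have hx0 := vnorm_nonneg x
    have hu' : mnorm Φuh ≤ ρ / γ₁ := by rwa [le_div_iff₀' hγ₁]
    have hΔv (w : b → ℝ) : vnorm (Δ *ᵥ w) ≤ γ₁ * vnorm w :=
      (vnorm_mulVec_le _ _).trans (mul_le_mul_of_nonneg_right hΔ (vnorm_nonneg w))
    have hy : vnorm (Δ *ᵥ (Φuh *ᵥ x)) ≤ ρ * vnorm x :=
      calc _ ≤ γ₁ * (mnorm Φuh * vnorm x) :=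
            (hΔv _).trans (mul_le_mul_of_nonneg_left (vnorm_mulVec_le _ _) hγ₁.le)
        _ = γ₁ * mnorm Φuh * vnorm x := by ring
        _ ≤ ρ * vnorm x := mul_le_mul_of_nonneg_right hΦuh hx0
    have hxle : vnorm x ≤ γ₁ / (1 - ρ) * vnorm φuh := by
      rw [div_mul_eq_mul_div]
      exact (vnorm_le_div_of_eq_add hρ1 hfix hy).trans
        (div_le_div_of_nonneg_right (hΔv φuh) h1ρ.le)
    rw [← Matrix.mulVec_mulVec, ← Matrix.mulVec_mulVec, ← hx, vnorm_fromRows_mulVec]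
    calc _ ≤ σ * vnorm x + ρ / γ₁ * vnorm x := add_le_add
          ((vnorm_mulVec_le _ _).trans (mul_le_mul_of_nonneg_right hΦyh hx0))
          ((vnorm_mulVec_le _ _).trans (mul_le_mul_of_nonneg_right hu' hx0))
      _ = (ρ / γ₁ + σ) * vnorm x := by ring
      _ ≤ (ρ / γ₁ + σ) * (γ₁ / (1 - ρ) * vnorm φuh) :=
          mul_le_mul_of_nonneg_left hxle (by positivity)
      _ = _ := by ring
  · rw [Matrix.nonsing_inv_apply_not_isUnit _ hu, Matrix.mul_zero, Matrix.zero_mul,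
      Matrix.zero_mulVec]
    simp only [vnorm, Pi.zero_apply, abs_zero, Finset.sum_const_zero] at hv ⊢
    positivity
end
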